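/- The following statements are equivalent: (i) for every n ≥ 1, HVC[n] holds for the Laplace operator Δ_n = D_1² + ⋯ + D_n²; (ii) for every n ≥ 1, VC[n] holds for the Laplace operator Δ_n; (iii) for every n ≥ 1 and every symmetric A ∈ SM(n, ℂ), HVC[n] holds for Δ_A; (iv) for every n ≥ 1 and every symmetric A ∈ SM(n, ℂ), VC[n] holds for Δ_A. -/

import Mathlib

open MvPolynomial

noncomputable def Delta {n : ℕ} (A : Matrix (Fin n) (Fin n) ℂ) :
    Module.End ℂ (MvPolynomial (Fin n) ℂ) :=
  ∑ i, ∑ j, A i j • ((pderiv i).toLinearMap ∘ₗ (pderiv j).toLinearMap)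

/-- `P` is `Λ`-nilpotent: `Λ^m(P^m) = 0` for all `m ≥ 1`. -/
def LNil {n : ℕ} (Λ : Module.End ℂ (MvPolynomial (Fin n) ℂ))
    (P : MvPolynomial (Fin n) ℂ) : Prop :=
  ∀ m : ℕ, 1 ≤ m → (Λ ^ m) (P ^ m) = 0

/-- The Vanishing Conjecture holds for `Λ`. -/
def VC {n : ℕ} (Λ : Module.End ℂ (MvPolynomial (Fin n) ℂ)) : Prop :=
  ∀ P : MvPolynomial (Fin n) ℂ, LNil Λ P →
    ∃ N : ℕ, ∀ m : ℕ, N ≤ m → (Λ ^ m) (P ^ (m + 1)) = 0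

/-- The homogeneous Vanishing Conjecture holds for `Λ`. -/
def HVC {n : ℕ} (Λ : Module.End ℂ (MvPolynomial (Fin n) ℂ)) : Prop :=
  ∀ P : MvPolynomial (Fin n) ℂ, (∃ d : ℕ, P.IsHomogeneous d) → LNil Λ P →
    ∃ N : ℕ, ∀ m : ℕ, N ≤ m → (Λ ^ m) (P ^ (m + 1)) = 0

/-- Chain rule for substitution of affine forms. -/
lemma pderiv_aeval_affine {n N : ℕ} (B : Matrix (Fin n) (Fin N) ℂ)
    (f : Fin n → MvPolynomial (Fin N) ℂ) (hf : ∀ i k, pderiv k (f i) = C (B i k))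
    (k : Fin N) (P : MvPolynomial (Fin n) ℂ) :
    pderiv k (aeval f P) = ∑ i, B i k • aeval f (pderiv i P) := by
  classical
  induction P using MvPolynomial.induction_on with
  | C a => simp
  | add p q hp hq => simp only [map_add, hp, hq, smul_add, Finset.sum_add_distrib]
  | mul_X p j h =>
    simp only [map_mul, aeval_X, Derivation.leibniz, smul_eq_mul, h, hf, map_add, pderiv_X,
      smul_add, Finset.sum_add_distrib, Finset.mul_sum]
    congr 1
    · rw [Finset.sum_eq_single j]
      · simp [smul_eq_C_mul, mul_comm]
      · intro b _ hb
        simp [Ne.symm hb]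
      · simp
    · exact Finset.sum_congr rfl fun i _ => by simp [smul_eq_C_mul]; ring

lemma Delta_apply {n : ℕ} (A : Matrix (Fin n) (Fin n) ℂ) (P : MvPolynomial (Fin n) ℂ) :
    Delta A P = ∑ i, ∑ j, A i j • pderiv i (pderiv j P) := by
  simp [Delta, LinearMap.sum_apply]

/-- Substituting affine forms with linear part `B` intertwines `Δ_A` and `Δ_{B A Bᵀ}`. -/
lemma Delta_aeval_affine {n N : ℕ} (B : Matrix (Fin n) (Fin N) ℂ)
    (f : Fin n → MvPolynomial (Fin N) ℂ) (hf : ∀ i k, pderiv k (f i) = C (B i k))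
    (A : Matrix (Fin N) (Fin N) ℂ) (P : MvPolynomial (Fin n) ℂ) :
    Delta A (aeval f P) = aeval f (Delta (B * A * B.transpose) P) := by
  have h (k l : Fin N) : pderiv k (pderiv l (aeval f P)) =
      ∑ i, ∑ j, (B i k * B j l) • aeval f (pderiv i (pderiv j P)) := by
    rw [pderiv_aeval_affine B f hf, map_sum, Finset.sum_comm]
    simp only [Derivation.map_smul, pderiv_aeval_affine B f hf, Finset.smul_sum, smul_smul,
      mul_comm]
  simp only [Delta_apply, h, map_sum, map_smul, Matrix.mul_apply, Matrix.transpose_apply,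
    Finset.sum_smul, Finset.smul_sum, Finset.sum_mul, smul_smul]
  rw [Finset.sum_congr rfl fun k _ => Finset.sum_comm, Finset.sum_comm]
  refine Finset.sum_congr rfl fun i _ => ?_
  rw [Finset.sum_comm_cycle]
  refine Finset.sum_congr rfl fun j _ => ?_
  rw [Finset.sum_comm]
  refine Finset.sum_congr rfl fun l _ => Finset.sum_congr rfl fun k _ => ?_
  congr 1
  ring

lemma Delta_pow_aeval_affine {n N : ℕ} (B : Matrix (Fin n) (Fin N) ℂ)
    (f : Fin n → MvPolynomial (Fin N) ℂ) (hf : ∀ i k, pderiv k (f i) = C (B i k))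
    (A : Matrix (Fin N) (Fin N) ℂ) (m : ℕ) (P : MvPolynomial (Fin n) ℂ) :
    (Delta A ^ m) (aeval f P) = aeval f ((Delta (B * A * B.transpose) ^ m) P) := by
  induction m generalizing P with
  | zero => rfl
  | succ m ih =>
    rw [pow_succ, pow_succ, Module.End.mul_apply, Module.End.mul_apply,
      Delta_aeval_affine B f hf, ih]

lemma isHomogeneous_Delta_pow {n : ℕ} (A : Matrix (Fin n) (Fin n) ℂ) (m : ℕ)
    {P : MvPolynomial (Fin n) ℂ} {d : ℕ} (hP : P.IsHomogeneous d) :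
    ∃ k, ((Delta A ^ m) P).IsHomogeneous k := by
  induction m generalizing P d with
  | zero => exact ⟨d, hP⟩
  | succ m ih =>
    rw [pow_succ, Module.End.mul_apply]
    refine ih (d := d - 1 - 1) ?_
    rw [Delta_apply]
    refine IsHomogeneous.sum _ _ _ fun i _ => IsHomogeneous.sum _ _ _ fun j _ => ?_
    rw [smul_eq_C_mul]
    exact hP.pderiv.pderiv.C_mul _

/-- Dehomogenization: setting the variable `X 0` equal to `1`. -/
noncomputable abbrev dehomForms (n : ℕ) : Fin (n + 1) → MvPolynomial (Fin n) ℂ :=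
  Fin.cons 1 X

lemma eq_zero_of_dehom_eq_zero {n k : ℕ} {Q : MvPolynomial (Fin (n + 1)) ℂ}
    (hQ : Q.IsHomogeneous k) (h : aeval (dehomForms n) Q = 0) : Q = 0 := by
  have hX : (X 0 : MvPolynomial (Fin (n + 1)) ℂ) * Q = 0 := by
    refine MvPolynomial.funext fun x => ?_
    rw [map_mul, eval_X, map_zero, mul_eq_zero]
    refine or_iff_not_imp_left.2 fun hx => ?_
    have h1 := congrArg (eval fun i => (x 0)⁻¹ * x (Fin.succ i)) h
    have h2 : eval (fun i => (x 0)⁻¹ * x i) Q = 0 := by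
      rw [← map_zero (eval fun i => (x 0)⁻¹ * x (Fin.succ i)), ← h1, aeval_def,
        ← coe_eval₂Hom, ← RingHom.comp_apply]
      congr 1
      refine MvPolynomial.ringHom_ext (by simp) fun i => ?_
      refine Fin.cases ?_ (fun i => ?_) i <;> simp [hx]
    have h3 : eval (fun i => (x 0)⁻¹ * x i) Q = (x 0)⁻¹ ^ k * eval x Q := by
      rw [eval_eq, eval_eq, Finset.mul_sum]
      refine Finset.sum_congr rfl fun d hd => ?_
      simp only [mul_pow, Finset.prod_mul_distrib, Finset.prod_pow_eq_pow_sum]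
      rw [← hQ.degree_eq_sum_deg_support hd]
      ring
    rw [h3] at h2
    simpa [hx] using h2
  exact (mul_eq_zero.1 hX).resolve_left (X_ne_zero _)

lemma exists_homogenization {n : ℕ} (P : MvPolynomial (Fin n) ℂ) :
    ∃ (d : ℕ) (Q : MvPolynomial (Fin (n + 1)) ℂ), Q.IsHomogeneous d ∧
      aeval (dehomForms n) Q = P := by
  refine ⟨P.totalDegree, ∑ i ∈ Finset.range (P.totalDegree + 1),
    X 0 ^ (P.totalDegree - i) * rename Fin.succ (homogeneousComponent i P), ?_, ?_⟩
  · refine IsHomogeneous.sum _ _ _ fun i hi => ?_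
    have := (isHomogeneous_X_pow (R := ℂ) (0 : Fin (n + 1)) (P.totalDegree - i)).mul
      ((homogeneousComponent_isHomogeneous i P).rename_isHomogeneous (f := Fin.succ))
    rwa [Nat.sub_add_cancel (Nat.lt_succ_iff.1 (Finset.mem_range.1 hi))] at this
  · have hc : dehomForms n ∘ Fin.succ = X := rfl
    simp only [map_sum, map_mul, map_pow, aeval_X, aeval_rename, hc, aeval_X_left_apply]
    simpa using sum_homogeneousComponent P

lemma VC_of_forall_HVC
    (H : ∀ n : ℕ, 1 ≤ n → ∀ A : Matrix (Fin n) (Fin n) ℂ, A.IsSymm → HVC (Delta A))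
    {n : ℕ} (A : Matrix (Fin n) (Fin n) ℂ) (hA : A.IsSymm) : VC (Delta A) := by
  intro P hP
  obtain ⟨d, Q, hQ, rfl⟩ := exists_homogenization P
  let B : Matrix (Fin (n + 1)) (Fin n) ℂ := 
    Matrix.of (Fin.cons 0 fun i => (1 : Matrix (Fin n) (Fin n) ℂ) i)
  have hB : ∀ i k, pderiv k (dehomForms n i) = C (B i k) := by
    intro i k
    refine Fin.cases ?_ (fun i => ?_) i
    · have h0 : B 0 k = 0 := rfl
      simp [h0]
    · have hs : B i.succ k = (1 : Matrix (Fin n) (Fin n) ℂ) i k := rfl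
      rw [hs]
      rcases eq_or_ne i k with rfl | hik
      · simp
      · simp [hik]
  obtain ⟨N, hN⟩ := H (n + 1) (Nat.le_add_left 1 n) (B * A * B.transpose)
    (by simp [Matrix.IsSymm, Matrix.transpose_mul, hA.eq, Matrix.mul_assoc]) Q ⟨d, hQ⟩ (by
      intro m hm
      obtain ⟨k, hk⟩ := isHomogeneous_Delta_pow (B * A * B.transpose) m (hQ.pow m)
      refine eq_zero_of_dehom_eq_zero hk ?_
      rw [← Delta_pow_aeval_affine B _ hB, map_pow]
      exact hP m hm)
  refine ⟨N, fun m hm => ?_⟩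
  rw [← map_pow, Delta_pow_aeval_affine B _ hB, hN m hm, map_zero]

lemma HVC_of_forall_HVC_laplace
    (H : ∀ n : ℕ, 1 ≤ n → HVC (Delta (1 : Matrix (Fin n) (Fin n) ℂ)))
    {n : ℕ} (hn : 1 ≤ n) (A : Matrix (Fin n) (Fin n) ℂ) (hA : A.IsSymm) : HVC (Delta A) := by
  rintro P ⟨d, hd⟩ hP
  let S : Matrix (Fin n) (Fin n) ℂ := (4⁻¹ : ℂ) • A + 1
  let T : Matrix (Fin n) (Fin n) ℂ := Complex.I • ((4⁻¹ : ℂ) • A - 1)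
  let B : Matrix (Fin n) (Fin (n + n)) ℂ := Matrix.of fun i => Fin.append (S i) (T i)
  let f : Fin n → MvPolynomial (Fin (n + n)) ℂ := fun i => ∑ k, C (B i k) * X k
  have hf : ∀ i k, pderiv k (f i) = C (B i k) := by
    classical
    intro i k
    simp [f, map_sum, Derivation.leibniz, pderiv_X, Pi.single_apply]
  have hBB : B * (1 : Matrix (Fin (n + n)) (Fin (n + n)) ℂ) * B.transpose = A := by
    have hST : S * S.transpose + T * T.transpose = A := by
      have hT : A.transpose = A := hA
      simp only [S, T, Matrix.transpose_add, Matrix.transpose_sub, Matrix.transpose_smul, hT,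
        Matrix.transpose_one, Matrix.smul_mul, Matrix.mul_smul, smul_smul, Complex.I_mul_I]
      simp only [add_mul, mul_add, sub_mul, mul_sub, one_mul, mul_one, neg_smul, one_smul]
      module
    rw [Matrix.mul_one, ← hST]
    ext i j
    simp [B, Matrix.mul_apply, Fin.sum_univ_add, -Fin.natAdd_eq_addNat]
  let g : Fin (n + n) → MvPolynomial (Fin n) ℂ :=
    Fin.append (fun j => C (2⁻¹ : ℂ) * X j) (fun j => C (2⁻¹ * Complex.I) * X j)
  have hgf (Q : MvPolynomial (Fin n) ℂ) : aeval g (aeval f Q) = Q := by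
    have : (aeval g).comp (aeval f) = AlgHom.id ℂ (MvPolynomial (Fin n) ℂ) := by
      refine MvPolynomial.algHom_ext fun i => ?_
      have key (j : Fin n) : C (S i j) * (C (2⁻¹ : ℂ) * X j) +
          C (T i j) * (C (2⁻¹ * Complex.I) * X j) =
            if j = i then (X j : MvPolynomial (Fin n) ℂ) else 0 := by
        rw [← mul_assoc, ← mul_assoc, ← C_mul, ← C_mul, ← add_mul, ← C_add]
        have : S i j * 2⁻¹ + T i j * (2⁻¹ * Complex.I) = if j = i then 1 else 0 := by
          have hI := Complex.I_mul_I
          simp only [S, T, Matrix.add_apply, Matrix.smul_apply, Matrix.sub_apply, smul_eq_mul,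
            Matrix.one_apply, eq_comm (a := i)]
          split_ifs
          · linear_combination (2⁻¹ : ℂ) * (4⁻¹ * A i j - 1) * hI
          · linear_combination (2⁻¹ : ℂ) * (4⁻¹ * A i j) * hI
        rw [this]
        split_ifs <;> simp
      have hg : aeval g (f i) = ∑ k, C (B i k) * g k := by simp [f]
      rw [AlgHom.comp_apply, aeval_X, hg]
      simp only [g, B, Matrix.of_apply, Fin.sum_univ_add, Fin.append_left,
        Fin.append_right, ← Finset.sum_add_distrib, key]
      simp
    exact DFunLike.congr_fun this Q
  have hfh : (aeval f P).IsHomogeneous d := by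
    have := hd.aeval f (n := 1) fun i =>
      IsHomogeneous.sum _ _ _ fun k _ => isHomogeneous_C_mul_X _ _
    simpa using this
  have hD (m : ℕ) (Q : MvPolynomial (Fin n) ℂ) :
      (Delta 1 ^ m) (aeval f Q) = aeval f ((Delta A ^ m) Q) := by
    rw [Delta_pow_aeval_affine B f hf, hBB]
  obtain ⟨N, hN⟩ := H (n + n) (by omega) (aeval f P) ⟨d, hfh⟩
    (fun m hm => by rw [← map_pow, hD, hP m hm, map_zero])
  refine ⟨N, fun m hm => ?_⟩
  have := hN m hm
  rw [← map_pow, hD] at this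
  rw [← hgf ((Delta A ^ m) (P ^ (m + 1))), this, map_zero]

/-- The equivalence of: (i) `HVC[n]` for the Laplace operators; (ii) `VC[n]` for the
Laplace operators; (iii) `HVC[n]` for all `Δ_A`; (iv) `VC[n]` for all `Δ_A`. -/
theorem stmt6 :
    List.TFAE [
      ∀ n : ℕ, 1 ≤ n → HVC (Delta (1 : Matrix (Fin n) (Fin n) ℂ)),
      ∀ n : ℕ, 1 ≤ n → VC (Delta (1 : Matrix (Fin n) (Fin n) ℂ)),
      ∀ n : ℕ, 1 ≤ n → ∀ A : Matrix (Fin n) (Fin n) ℂ, A.IsSymm → HVC (Delta A),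
      ∀ n : ℕ, 1 ≤ n → ∀ A : Matrix (Fin n) (Fin n) ℂ, A.IsSymm → VC (Delta A)] := by
  tfae_have 1 → 3 := fun H _ hn A hA => HVC_of_forall_HVC_laplace H hn A hA
  tfae_have 3 → 4 := fun H _ _ A hA => VC_of_forall_HVC H A hA
  tfae_have 4 → 2 := fun H n hn => H n hn 1 Matrix.isSymm_one
  tfae_have 2 → 1 := fun H n hn P _ hP => H n hn P hP
  tfae_finish
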